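/- Let q be a real number with 0 < q < 1. Then the third cumulant of the random variable γ_n^*(1) satisfies lim_{n→∞} ( e_{n,3}(q) - 3 e_{n,1}(q) e_{n,2}(q) + 2 e_{n,1}(q)^3 ) = - ∑_{m=1}^∞ σ_2(m) q^m. -/

import Mathlib

/-- The `k`-th moment `e_{n,k}(q) = ∑_{h=1}^n h^k q^{n-h} ∏_{j=1}^{h-1} (1 - q^{n-j})`
of the Simon–Crippa–Collenberg random variable `γ_n^*(1)`. -/
noncomputable def momentE (q : ℝ) (n k : ℕ) : ℝ :=
  ∑ h ∈ Finset.Icc 1 n, (h : ℝ) ^ k * q ^ (n - h) * ∏ j ∈ Finset.Icc 1 (h - 1), (1 - q ^ (n - j))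

open Filter Finset Topology

noncomputable def qPoch (q : ℝ) (m : ℕ) : ℝ := ∏ i ∈ range m, (1 - q ^ (i + 1))

noncomputable def uu (q : ℝ) (m : ℕ) : ℝ := q ^ m / qPoch q m

lemma qPoch_pos (q : ℝ) (hq0 : 0 < q) (hq1 : q < 1) (m : ℕ) : 0 < qPoch q m := by
  unfold qPoch
  refine prod_pos fun i _ => ?_
  have := pow_lt_one₀ hq0.le hq1 (Nat.succ_ne_zero i)
  simpa using this

lemma qPoch_succ (q : ℝ) (m : ℕ) : qPoch q (m + 1) = qPoch q m * (1 - q ^ (m + 1)) := by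
  unfold qPoch
  rw [prod_range_succ]

lemma uu_zero (q : ℝ) : uu q 0 = 1 := by simp [uu, qPoch]

lemma uu_pos (q : ℝ) (hq0 : 0 < q) (hq1 : q < 1) (m : ℕ) : 0 < uu q m :=
  div_pos (pow_pos hq0 m) (qPoch_pos q hq0 hq1 m)

lemma one_sub_pos' (q : ℝ) (hq0 : 0 < q) (hq1 : q < 1) (m : ℕ) : 0 < 1 - q ^ (m + 1) := by
  have := pow_lt_one₀ hq0.le hq1 (Nat.succ_ne_zero m)
  simpa using this

lemma uu_succ (q : ℝ) (hq0 : 0 < q) (hq1 : q < 1) (m : ℕ) :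
    (1 - q ^ (m + 1)) * uu q (m + 1) = q * uu q m := by
  unfold uu
  rw [qPoch_succ]
  have h1 := (qPoch_pos q hq0 hq1 m).ne'
  have h2 := (one_sub_pos' q hq0 hq1 m).ne'
  field_simp
  ring

lemma sum_uu (q : ℝ) (hq0 : 0 < q) (hq1 : q < 1) (n : ℕ) :
    qPoch q n * ∑ m ∈ range (n + 1), uu q m = 1 := by
  induction n with
  | zero => simp [uu, qPoch]
  | succ n ih =>
    rw [sum_range_succ, mul_add, qPoch_succ]
    have h1 := (qPoch_pos q hq0 hq1 n).ne'
    have h2 := (one_sub_pos' q hq0 hq1 n).ne'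
    have h3 : qPoch q n * (1 - q ^ (n + 1)) * uu q (n + 1) = q ^ (n + 1) := by
      unfold uu
      rw [qPoch_succ]
      field_simp
    rw [h3]
    linear_combination (1 - q ^ (n + 1)) * ih

lemma prod_shift (q : ℝ) (n d : ℕ) (hd : d ≤ n) :
    (∏ j ∈ Icc 1 d, (1 - q ^ (n + 1 - j))) * qPoch q (n - d) = qPoch q n := by
  induction d with
  | zero => simp
  | succ d ih =>
    rw [prod_Icc_succ_top (by omega), ← ih (by omega)]
    obtain ⟨c, rfl⟩ : ∃ c, n = d + 1 + c := ⟨n - (d + 1), by omega⟩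
    rw [show d + 1 + c - d = c + 1 by omega, qPoch_succ,
      show d + 1 + c - (d + 1) = c by omega, show d + 1 + c + 1 - (d + 1) = c + 1 by omega]
    ring

lemma momentE_eq (q : ℝ) (hq0 : 0 < q) (hq1 : q < 1) (n k : ℕ) :
    momentE q (n + 1) k =
      qPoch q n * ∑ m ∈ range (n + 1), ((n : ℝ) + 1 - m) ^ k * uu q m := by
  unfold momentE
  rw [mul_sum]
  refine sum_bij' (fun h _ => n + 1 - h) (fun m _ => n + 1 - m) ?_ ?_ ?_ ?_ ?_
  · intro h hh; simp at hh ⊢; omega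
  · intro h hh; simp at hh ⊢; omega
  · intro h hh; simp at hh ⊢; omega
  · intro h hh; simp at hh ⊢; omega
  · intro h hh
    simp only [mem_Icc] at hh
    obtain ⟨h1, h2⟩ := hh
    have hp := prod_shift q n (h - 1) (by omega)
    rw [show n - (h - 1) = n + 1 - h by omega] at hp
    have h3 := (qPoch_pos q hq0 hq1 (n + 1 - h)).ne'
    rw [← hp]
    unfold uu
    rw [Nat.cast_sub h2]
    push_cast
    field_simp
    ring

noncomputable def TT (q : ℝ) (n k : ℕ) : ℝ := ∑ m ∈ range n, (m : ℝ) ^ k * uu q m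

noncomputable def SS (q : ℝ) (k i : ℕ) : ℝ := ∑' m : ℕ, (m : ℝ) ^ k * uu q m * q ^ (i * m)

noncomputable def kap (a b c d : ℝ) : ℝ := (d * a ^ 2 - 3 * b * c * a + 2 * b ^ 3) / a ^ 3

lemma cumulant_eq (q : ℝ) (hq0 : 0 < q) (hq1 : q < 1) (n : ℕ) :
    momentE q (n + 1) 3 - 3 * momentE q (n + 1) 1 * momentE q (n + 1) 2
      + 2 * (momentE q (n + 1) 1) ^ 3 =
    - kap (TT q (n + 1) 0) (TT q (n + 1) 1) (TT q (n + 1) 2) (TT q (n + 1) 3) := by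
  have e0 : qPoch q n * TT q (n + 1) 0 = 1 := by simpa [TT] using sum_uu q hq0 hq1 n
  have e1 : momentE q (n + 1) 1 = qPoch q n * ((n + 1) * TT q (n + 1) 0 - TT q (n + 1) 1) := by
    rw [momentE_eq q hq0 hq1]
    congr 1
    simp only [TT, mul_sum, ← sum_sub_distrib]
    exact sum_congr rfl fun m _ => by ring
  have e2 : momentE q (n + 1) 2 = qPoch q n * ((n + 1) ^ 2 * TT q (n + 1) 0
      - 2 * (n + 1) * TT q (n + 1) 1 + TT q (n + 1) 2) := by
    rw [momentE_eq q hq0 hq1]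
    congr 1
    simp only [TT, mul_sum, ← sum_sub_distrib, ← sum_add_distrib]
    exact sum_congr rfl fun m _ => by ring
  have e3 : momentE q (n + 1) 3 = qPoch q n * ((n + 1) ^ 3 * TT q (n + 1) 0
      - 3 * (n + 1) ^ 2 * TT q (n + 1) 1 + 3 * (n + 1) * TT q (n + 1) 2 - TT q (n + 1) 3) := by
    rw [momentE_eq q hq0 hq1]
    congr 1
    simp only [TT, mul_sum, ← sum_sub_distrib, ← sum_add_distrib]
    exact sum_congr rfl fun m _ => by ring
  have hp := qPoch_pos q hq0 hq1 n
  have e4 : TT q (n + 1) 0 ≠ 0 := by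
    intro h; rw [h] at e0; simp at e0
  have e5 : qPoch q n = 1 / TT q (n + 1) 0 := by
    field_simp; linarith
  rw [e1, e2, e3, e5]
  unfold kap
  field_simp
  ring

lemma summable_base (q : ℝ) (hq0 : 0 < q) (hq1 : q < 1) (k : ℕ) :
    Summable fun m : ℕ => (m : ℝ) ^ k * uu q m := by
  have hU : Tendsto (fun m : ℕ => q / (1 - q ^ (m + 1))) atTop (𝓝 q) := by
    have h := ((tendsto_pow_atTop_nhds_zero_of_lt_one hq0.le hq1).comp
      (tendsto_add_atTop_nat 1)).const_sub 1
    have h2 := (tendsto_const_nhds (x := q)).div h (by simp)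
    rw [sub_zero, div_one] at h2
    exact h2
  have hN : Tendsto (fun m : ℕ => (((m : ℝ) + 1) / m) ^ k) atTop (𝓝 1) := by
    have h : Tendsto (fun m : ℕ => ((m : ℝ) + 1) / m) atTop (𝓝 1) := by
      have h1 := (tendsto_const_div_atTop_nhds_zero_nat (1 : ℝ)).const_add 1
      rw [add_zero] at h1
      refine h1.congr' ?_
      filter_upwards [eventually_gt_atTop 0] with m hm
      have : (m : ℝ) ≠ 0 := by positivity
      field_simp
    simpa using h.pow k
  refine summable_of_ratio_test_tendsto_lt_one hq1 ?_ ((hN.mul hU).congr' ?_ |>.trans (by simp))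
  · filter_upwards [eventually_gt_atTop 0] with m hm
    have := uu_pos q hq0 hq1 m
    positivity
  · filter_upwards [eventually_gt_atTop 0] with m hm
    have h1 := uu_pos q hq0 hq1 m
    have h2 := uu_pos q hq0 hq1 (m + 1)
    have h3 := one_sub_pos' q hq0 hq1 m
    have h4 := uu_succ q hq0 hq1 m
    have h5 : uu q (m + 1) = q * uu q m / (1 - q ^ (m + 1)) := by
      field_simp; linarith
    have h6 : (m : ℝ) ≠ 0 := by positivity
    rw [Real.norm_of_nonneg (by positivity), Real.norm_of_nonneg (by positivity), h5]
    push_cast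
    rw [div_pow]
    field_simp

lemma summable_S (q : ℝ) (hq0 : 0 < q) (hq1 : q < 1) (k i : ℕ) :
    Summable fun m : ℕ => (m : ℝ) ^ k * uu q m * q ^ (i * m) := by
  refine Summable.of_nonneg_of_le (fun m => ?_) (fun m => ?_) (summable_base q hq0 hq1 k)
  · have := uu_pos q hq0 hq1 m
    positivity
  · have := uu_pos q hq0 hq1 m
    exact mul_le_of_le_one_right (by positivity) (pow_le_one₀ hq0.le hq1.le)

lemma SS_succ (q : ℝ) (hq0 : 0 < q) (hq1 : q < 1) (k i : ℕ) :
    SS q k (i + 1) = SS q k i -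
      ∑' m : ℕ, q ^ (i + 1) * (((m : ℝ) + 1) ^ k * uu q m * q ^ (i * m)) := by
  have h1 := summable_S q hq0 hq1 k i
  have h2 := summable_S q hq0 hq1 k (i + 1)
  have h3 := h1.sub h2
  have : SS q k i - SS q k (i + 1) =
      ∑' m : ℕ, q ^ (i + 1) * (((m : ℝ) + 1) ^ k * uu q m * q ^ (i * m)) := by
    unfold SS
    rw [← h1.tsum_sub h2, h3.tsum_eq_zero_add]
    simp only [mul_zero, pow_zero, sub_self, zero_add]
    refine tsum_congr fun m => ?_
    have h4 := uu_succ q hq0 hq1 m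
    push_cast
    have : q ^ ((i + 1) * (m + 1)) = q ^ (i * (m + 1)) * q ^ (m + 1) := by ring
    rw [this]
    have : q ^ (i * (m + 1)) = q ^ i * q ^ (i * m) := by ring
    rw [this]
    linear_combination ((m : ℝ) + 1) ^ k * q ^ i * q ^ (i * m) * h4
  linarith

lemma SS_rec (q : ℝ) (hq0 : 0 < q) (hq1 : q < 1) (i : ℕ) :
    SS q 0 (i + 1) = SS q 0 i - q ^ (i + 1) * SS q 0 i ∧
    SS q 1 (i + 1) = SS q 1 i - q ^ (i + 1) * (SS q 1 i + SS q 0 i) ∧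
    SS q 2 (i + 1) = SS q 2 i - q ^ (i + 1) * (SS q 2 i + 2 * SS q 1 i + SS q 0 i) ∧
    SS q 3 (i + 1) = SS q 3 i -
      q ^ (i + 1) * (SS q 3 i + 3 * SS q 2 i + 3 * SS q 1 i + SS q 0 i) := by
  have s := fun k => (summable_S q hq0 hq1 k i).hasSum
  refine ⟨?_, ?_, ?_, ?_⟩ <;> rw [SS_succ q hq0 hq1, tsum_mul_left]
  · simp [SS]
  · congr 2
    refine HasSum.tsum_eq ?_
    convert! (s 1).add (s 0) using 2
    ring
  · congr 2
    refine HasSum.tsum_eq ?_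
    convert! ((s 2).add ((s 1).mul_left 2)).add (s 0) using 2
    ring
  · congr 2
    refine HasSum.tsum_eq ?_
    convert! (((s 3).add ((s 2).mul_left 3)).add ((s 1).mul_left 3)).add (s 0) using 2
    ring

lemma SS_zero_pos (q : ℝ) (hq0 : 0 < q) (hq1 : q < 1) (i : ℕ) : 0 < SS q 0 i := by
  refine (summable_S q hq0 hq1 0 i).tsum_pos (fun m => ?_) 0 ?_
  · have := uu_pos q hq0 hq1 m
    positivity
  · simp [uu_zero]

noncomputable def KK (q : ℝ) (i : ℕ) : ℝ := kap (SS q 0 i) (SS q 1 i) (SS q 2 i) (SS q 3 i)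

noncomputable def gg (x : ℝ) : ℝ := x * (1 + x) / (1 - x) ^ 3

lemma KK_succ (q : ℝ) (hq0 : 0 < q) (hq1 : q < 1) (i : ℕ) :
    KK q i - KK q (i + 1) = gg (q ^ (i + 1)) := by
  obtain ⟨h0, h1, h2, h3⟩ := SS_rec q hq0 hq1 i
  have hp := (SS_zero_pos q hq0 hq1 i).ne'
  have hx := (one_sub_pos' q hq0 hq1 i).ne'
  unfold KK gg kap
  rw [h0, h1, h2, h3]
  generalize q ^ (i + 1) = x at *
  have : SS q 0 i - x * SS q 0 i = (1 - x) * SS q 0 i := by ring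
  rw [this]
  generalize SS q 0 i = a at *
  generalize SS q 1 i = b at *
  generalize SS q 2 i = c at *
  generalize SS q 3 i = d at *
  field_simp
  ring

lemma SS_tendsto (q : ℝ) (hq0 : 0 < q) (hq1 : q < 1) (k : ℕ) :
    Tendsto (fun i => SS q k i) atTop (𝓝 (if k = 0 then 1 else 0)) := by
  have h : Tendsto (fun i => SS q k i) atTop
      (𝓝 (∑' m : ℕ, if m = 0 then (if k = 0 then (1 : ℝ) else 0) else 0)) := by
    unfold SS
    refine tendsto_tsum_of_dominated_convergence (summable_base q hq0 hq1 k) ?_ ?_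
    · intro m
      rcases Nat.eq_zero_or_pos m with rfl | hm
      · simp only [mul_zero, pow_zero, mul_one, uu_zero, if_true, Nat.cast_zero]
        by_cases hk : k = 0
        · simp [hk]
        · simp [hk]
      · have h1 : Tendsto (fun i : ℕ => (q ^ m) ^ i) atTop (𝓝 0) :=
          tendsto_pow_atTop_nhds_zero_of_lt_one (by positivity)
            (pow_lt_one₀ hq0.le hq1 (by omega))
        have h2 := h1.const_mul ((m : ℝ) ^ k * uu q m)
        rw [mul_zero] at h2
        rw [if_neg (by omega)]
        refine h2.congr fun i => ?_
        rw [← pow_mul, mul_comm m i]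
    · refine Eventually.of_forall fun i m => ?_
      have := uu_pos q hq0 hq1 m
      rw [Real.norm_of_nonneg (by positivity)]
      exact mul_le_of_le_one_right (by positivity) (pow_le_one₀ hq0.le hq1.le)
  rwa [tsum_ite_eq] at h

lemma kap_tendsto {a b c d : ℕ → ℝ} {A B C D : ℝ} (ha : Tendsto a atTop (𝓝 A))
    (hb : Tendsto b atTop (𝓝 B)) (hc : Tendsto c atTop (𝓝 C)) (hd : Tendsto d atTop (𝓝 D))
    (hA : A ≠ 0) :
    Tendsto (fun i => kap (a i) (b i) (c i) (d i)) atTop (𝓝 (kap A B C D)) := by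
  unfold kap
  exact (((hd.mul (ha.pow 2)).sub (((hb.const_mul 3).mul hc).mul ha)).add
    ((hb.pow 3).const_mul 2)).div (ha.pow 3) (pow_ne_zero 3 hA)

lemma KK_tendsto (q : ℝ) (hq0 : 0 < q) (hq1 : q < 1) :
    Tendsto (KK q) atTop (𝓝 0) := by
  have h := kap_tendsto (SS_tendsto q hq0 hq1 0) (SS_tendsto q hq0 hq1 1)
    (SS_tendsto q hq0 hq1 2) (SS_tendsto q hq0 hq1 3) (by simp)
  have e : kap (if (0 : ℕ) = 0 then 1 else 0) (if (1 : ℕ) = 0 then 1 else 0)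
      (if (2 : ℕ) = 0 then 1 else 0) (if (3 : ℕ) = 0 then 1 else 0) = 0 := by
    simp [kap]
  rw [e] at h
  exact h

lemma hasSum_gg (q : ℝ) (hq0 : 0 < q) (hq1 : q < 1) :
    HasSum (fun i : ℕ => gg (q ^ (i + 1))) (KK q 0) := by
  rw [hasSum_iff_tendsto_nat_of_nonneg]
  · have h : ∀ n, ∑ i ∈ range n, gg (q ^ (i + 1)) = KK q 0 - KK q n := by
      intro n
      rw [← sum_range_sub' (KK q) n]
      exact sum_congr rfl fun i _ => (KK_succ q hq0 hq1 i).symm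
    simp only [h]
    simpa using (KK_tendsto q hq0 hq1).const_sub (KK q 0)
  · intro i
    have := one_sub_pos' q hq0 hq1 i
    unfold gg
    positivity

lemma hasSum_sq (x : ℝ) (hx0 : 0 ≤ x) (hx : x < 1) :
    HasSum (fun k : ℕ => (k : ℝ) ^ 2 * x ^ k) (gg x) := by
  have hn : ‖x‖ < 1 := by rwa [Real.norm_of_nonneg hx0]
  have h2 := hasSum_choose_mul_geometric_of_norm_lt_one 2 hn
  have h1 := hasSum_choose_mul_geometric_of_norm_lt_one 1 hn
  have h0 := hasSum_choose_mul_geometric_of_norm_lt_one 0 hn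
  have h := ((h2.mul_left 2).sub (h1.mul_left 3)).add h0
  convert! h using 1
  · funext k
    rw [Nat.cast_choose_two]
    simp
    ring
  · unfold gg
    have : 1 - x ≠ 0 := by linarith
    field_simp
    ring

lemma tsum_sigma_eq (q : ℝ) (hq0 : 0 < q) (hq1 : q < 1) :
    ∑' m : ℕ, (∑ d ∈ (m + 1).divisors, (d : ℝ) ^ 2) * q ^ (m + 1) = KK q 0 := by
  have hn : ‖q‖ < 1 := by rwa [Real.norm_of_nonneg hq0.le]
  have h := tsum_prod_pow_eq_tsum_sigma 2 hn
  rw [tsum_pnat_eq_tsum_succ (f := fun e : ℕ => ((ArithmeticFunction.sigma 2 e : ℕ) : ℝ) * q ^ e),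
    tsum_pnat_eq_tsum_succ (f := fun d : ℕ => ∑' c : ℕ+, ((c : ℕ) : ℝ) ^ 2 * q ^ (d * c : ℕ))] at h
  rw [← (hasSum_gg q hq0 hq1).tsum_eq]
  trans ∑' e : ℕ, ((ArithmeticFunction.sigma 2 (e + 1) : ℕ) : ℝ) * q ^ (e + 1)
  · refine tsum_congr fun m => ?_
    rw [ArithmeticFunction.sigma_apply]
    push_cast
    rfl
  · rw [← h]
    refine tsum_congr fun i => ?_
    have hs := hasSum_sq (q ^ (i + 1)) (by positivity) (pow_lt_one₀ hq0.le hq1 (by omega))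
    rw [← hs.tsum_eq, hs.summable.tsum_eq_zero_add,
      tsum_pnat_eq_tsum_succ (f := fun c : ℕ => (c : ℝ) ^ 2 * q ^ ((i + 1) * c))]
    simp [pow_mul]

/-- For `0 < q < 1`, the third cumulant of `γ_n^*(1)` satisfies
`lim_{n→∞} (e_{n,3} - 3 e_{n,1} e_{n,2} + 2 e_{n,1}^3) = -∑_{m=1}^∞ σ_2(m) q^m`. -/
theorem third_cumulant_limit (q : ℝ) (hq0 : 0 < q) (hq1 : q < 1) :
    Filter.Tendsto
      (fun n : ℕ => momentE q n 3 - 3 * momentE q n 1 * momentE q n 2 + 2 * (momentE q n 1) ^ 3)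
      Filter.atTop
      (nhds (-(∑' m : ℕ, (∑ d ∈ (m + 1).divisors, (d : ℝ) ^ 2) * q ^ (m + 1)))) := by
  rw [tsum_sigma_eq q hq0 hq1]
  rw [← tendsto_add_atTop_iff_nat 1]
  simp only [cumulant_eq q hq0 hq1]
  have hT : ∀ k, Tendsto (fun n => TT q (n + 1) k) atTop (𝓝 (SS q k 0)) := by
    intro k
    have h := (summable_base q hq0 hq1 k).hasSum.tendsto_sum_nat
    have e : SS q k 0 = ∑' m : ℕ, (m : ℝ) ^ k * uu q m := by simp [SS]
    rw [e]
    exact h.comp (tendsto_add_atTop_nat 1)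
  exact (kap_tendsto (hT 0) (hT 1) (hT 2) (hT 3) (SS_zero_pos q hq0 hq1 0).ne').neg
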